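/- There is an absolute constant K such that for all t ≥ 3 and all primes p ≤ t, |Σ_{n≤t} α(n)·α(pn)/n − (6/π²)·((17/10080)·l⁸ + (1/210)·l⁷·log p)| ≤ K·(l⁷ + l⁸/p), where l = log t. -/

import Mathlib

/-- `α(n) = d^{(1,1)}(n) = Σ_{ab=n} (log a)(log b)`. -/
noncomputable def alphaFn (n : ℕ) : ℝ :=
  ∑ x ∈ n.divisorsAntidiagonal, Real.log x.1 * Real.log x.2

open Finset

/-- `F x = c (log x) ^ (m + 1) + O((1 + log x) ^ m)` for `x ≥ 1`. -/
def LogAsymp (F : ℝ → ℝ) (c : ℝ) (m : ℕ) : Prop :=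
  ∃ C, 0 ≤ C ∧ ∀ x, 1 ≤ x → |F x - c * Real.log x ^ (m + 1)| ≤ C * (1 + Real.log x) ^ m

lemma LogAsymp.add {F G : ℝ → ℝ} {c d : ℝ} {m : ℕ} (hF : LogAsymp F c m) (hG : LogAsymp G d m) :
    LogAsymp (fun x => F x + G x) (c + d) m := by
  obtain ⟨C, hC, hF⟩ := hF
  obtain ⟨D, hD, hG⟩ := hG
  refine ⟨C + D, by positivity, fun x hx => ?_⟩
  have h := abs_add_le (F x - c * Real.log x ^ (m + 1)) (G x - d * Real.log x ^ (m + 1))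
  have e : F x + G x - (c + d) * Real.log x ^ (m + 1) =
      (F x - c * Real.log x ^ (m + 1)) + (G x - d * Real.log x ^ (m + 1)) := by ring
  rw [e]
  linarith [hF x hx, hG x hx]

lemma pow_succ_sub_pow_succ_le {a b : ℝ} (hb : 0 ≤ b) (hab : b ≤ a) (i : ℕ) :
    a ^ (i + 1) - b ^ (i + 1) ≤ (i + 1) * (a - b) * a ^ i := by
  induction i with
  | zero => simp
  | succ i ih =>
    have h1 : b ^ (i + 1) ≤ a ^ (i + 1) := pow_le_pow_left₀ hb hab _
    have h2 := mul_le_mul_of_nonneg_left ih (hb.trans hab)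
    have h3 := mul_le_mul_of_nonneg_left h1 (sub_nonneg.2 hab)
    push_cast
    calc a ^ (i + 1 + 1) - b ^ (i + 1 + 1)
        = a * (a ^ (i + 1) - b ^ (i + 1)) + (a - b) * b ^ (i + 1) := by ring
      _ ≤ a * ((i + 1) * (a - b) * a ^ i) + (a - b) * a ^ (i + 1) := add_le_add h2 h3
      _ = _ := by ring

lemma mul_pow_le_pow_succ_sub_pow_succ {a b : ℝ} (hb : 0 ≤ b) (hab : b ≤ a) (i : ℕ) :
    (i + 1) * (a - b) * b ^ i ≤ a ^ (i + 1) - b ^ (i + 1) := by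
  induction i with
  | zero => simp
  | succ i ih =>
    have h1 : b ^ (i + 1) ≤ a ^ (i + 1) := pow_le_pow_left₀ hb hab _
    have h2 := mul_le_mul_of_nonneg_left ih hb
    have h3 := mul_le_mul_of_nonneg_left h1 (sub_nonneg.2 hab)
    push_cast
    calc ((i : ℝ) + 1 + 1) * (a - b) * b ^ (i + 1)
        = b * ((i + 1) * (a - b) * b ^ i) + (a - b) * b ^ (i + 1) := by ring
      _ ≤ b * (a ^ (i + 1) - b ^ (i + 1)) + (a - b) * a ^ (i + 1) := add_le_add h2 h3
      _ = _ := by ring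

lemma log_succ_sub_log_le {n : ℕ} (hn : 1 ≤ n) :
    Real.log (n + 1 : ℕ) - Real.log n ≤ 1 / n := by
  have hn' : (0 : ℝ) < n := by exact_mod_cast hn
  rw [← Real.log_div (by positivity) (by positivity)]
  refine (Real.log_le_sub_one_of_pos (by positivity)).trans (le_of_eq ?_)
  push_cast
  field_simp
  ring

lemma le_log_succ_sub_log {n : ℕ} (hn : 1 ≤ n) :
    1 / ((n + 1 : ℕ) : ℝ) ≤ Real.log (n + 1 : ℕ) - Real.log n := by
  have hn' : (0 : ℝ) < n := by exact_mod_cast hn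
  rw [← neg_sub, le_neg, ← Real.log_div (by positivity) (by positivity)]
  refine (Real.log_le_sub_one_of_pos (by positivity)).trans (le_of_eq ?_)
  push_cast
  field_simp
  ring

lemma sum_log_pow_div_le (i N : ℕ) (hN : 1 ≤ N) :
    ∑ n ∈ Icc 1 N, Real.log n ^ i / n ≤
      Real.log N ^ (i + 1) / (i + 1) + Real.log N ^ i + 1 := by
  induction N, hN using Nat.le_induction with
  | base => rcases i with _ | i <;> simp
  | succ N hN ih =>
    rw [Finset.sum_Icc_succ_top (by omega)]
    have hb : 0 ≤ Real.log N := Real.log_natCast_nonneg N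
    have h1 := le_log_succ_sub_log hN
    set a := Real.log ((N + 1 : ℕ) : ℝ)
    set b := Real.log (N : ℝ)
    have hN0 : (0 : ℝ) < ((N + 1 : ℕ) : ℝ) := by positivity
    have hab : b ≤ a := by
      have : 0 < 1 / ((N + 1 : ℕ) : ℝ) := by positivity
      linarith
    have h2 := mul_pow_le_pow_succ_sub_pow_succ hb hab i
    have h3 : b ^ i ≤ a ^ i := pow_le_pow_left₀ hb hab _
    have h4 : (1 : ℝ) / ((N + 1 : ℕ) : ℝ) ≤ 1 := by
      rw [div_le_one hN0]; push_cast; linarith [(Nat.cast_nonneg N : (0 : ℝ) ≤ N)]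
    have h5 : (a - b) * b ^ i ≤ a ^ (i + 1) / (i + 1) - b ^ (i + 1) / (i + 1) := by
      rw [← sub_div, le_div_iff₀ (by positivity)]
      linarith
    have h6 : 1 / ((N + 1 : ℕ) : ℝ) * b ^ i ≤ (a - b) * b ^ i := by gcongr
    have h7 : 1 / ((N + 1 : ℕ) : ℝ) * (a ^ i - b ^ i) ≤ 1 * (a ^ i - b ^ i) :=
      mul_le_mul_of_nonneg_right h4 (sub_nonneg.2 h3)
    have h8 : a ^ i / ((N + 1 : ℕ) : ℝ) =
      1 / ((N + 1 : ℕ) : ℝ) * b ^ i + 1 / ((N + 1 : ℕ) : ℝ) * (a ^ i - b ^ i) := by ring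
    linarith

lemma le_sum_log_pow_div (i N : ℕ) (hN : 1 ≤ N) :
    Real.log N ^ (i + 1) / (i + 1) ≤
      ∑ n ∈ Icc 1 N, Real.log n ^ i / n + Real.log N ^ i * (1 - 1 / N) := by
  induction N, hN using Nat.le_induction with
  | base => rcases i with _ | i <;> simp
  | succ N hN ih =>
    rw [Finset.sum_Icc_succ_top (by omega)]
    have hb : 0 ≤ Real.log N := Real.log_natCast_nonneg N
    have h1 := log_succ_sub_log_le hN
    have hN1 : (1 : ℝ) ≤ N := by exact_mod_cast hN
    have hab : Real.log (N : ℝ) ≤ Real.log ((N + 1 : ℕ) : ℝ) :=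
      Real.log_le_log (by linarith) (by push_cast; linarith)
    set a := Real.log ((N + 1 : ℕ) : ℝ)
    set b := Real.log (N : ℝ)
    have h2 := pow_succ_sub_pow_succ_le hb hab i
    have h3 : b ^ i ≤ a ^ i := pow_le_pow_left₀ hb hab _
    have h5 : a ^ (i + 1) / (i + 1) - b ^ (i + 1) / (i + 1) ≤ (a - b) * a ^ i := by
      rw [← sub_div, div_le_iff₀ (by positivity)]
      linarith
    have ha : 0 ≤ a := hb.trans hab
    have h6 : (a - b) * a ^ i ≤ 1 / N * a ^ i := by gcongr
    have h4 : (1 : ℝ) / N ≤ 1 := by rw [div_le_one (by linarith)]; linarith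
    have h7 : b ^ i * (1 - 1 / N) ≤ a ^ i * (1 - 1 / N) :=
      mul_le_mul_of_nonneg_right h3 (by linarith)
    have h8 : a ^ i / ((N + 1 : ℕ) : ℝ) + a ^ i * (1 - 1 / ((N + 1 : ℕ) : ℝ)) = a ^ i := by ring
    have h9 : 1 / (N : ℝ) * a ^ i + a ^ i * (1 - 1 / N) = a ^ i := by ring
    linarith

lemma logAsymp_sum_log_pow_div (i : ℕ) :
    LogAsymp (fun x => ∑ n ∈ Icc 1 ⌊x⌋₊, Real.log n ^ i / n) (1 / (i + 1)) i := by
  refine ⟨3, by norm_num, fun x hx => ?_⟩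
  have hN : 1 ≤ ⌊x⌋₊ := Nat.le_floor (by exact_mod_cast hx)
  have h1 := sum_log_pow_div_le i _ hN
  have h2 := le_sum_log_pow_div i _ hN
  have hN' : (1 : ℝ) ≤ ⌊x⌋₊ := by exact_mod_cast hN
  have hb : 0 ≤ Real.log ⌊x⌋₊ := Real.log_natCast_nonneg _
  have hab : Real.log ⌊x⌋₊ ≤ Real.log x :=
    Real.log_le_log (by linarith) (Nat.floor_le (by linarith))
  have hsub : Real.log x - Real.log ⌊x⌋₊ ≤ 1 := by
    have h := log_succ_sub_log_le hN
    have : Real.log x ≤ Real.log (⌊x⌋₊ + 1 : ℕ) :=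
      Real.log_le_log (by linarith) (by push_cast; exact (Nat.lt_floor_add_one x).le)
    have : 1 / (⌊x⌋₊ : ℝ) ≤ 1 := by rw [div_le_one (by linarith)]; exact hN'
    linarith
  set N : ℕ := ⌊x⌋₊
  set a := Real.log x
  set b := Real.log (N : ℝ)
  have h3 := pow_succ_sub_pow_succ_le hb hab i
  have h4 : b ^ (i + 1) ≤ a ^ (i + 1) := pow_le_pow_left₀ hb hab _
  have h5 : b ^ i ≤ a ^ i := pow_le_pow_left₀ hb hab _
  have ha : 0 ≤ a := hb.trans hab
  have h6 : a ^ i ≤ (1 + a) ^ i := pow_le_pow_left₀ ha (by linarith) _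
  have h7 : 1 ≤ (1 + a) ^ i := one_le_pow₀ (by linarith)
  have h8 : a ^ (i + 1) / (i + 1) - b ^ (i + 1) / (i + 1) ≤ (a - b) * a ^ i := by
    rw [← sub_div, div_le_iff₀ (by positivity)]
    linarith
  have h9 : (a - b) * a ^ i ≤ 1 * a ^ i := by gcongr
  have h10 : b ^ (i + 1) / (i + 1) ≤ a ^ (i + 1) / (i + 1) := by gcongr
  have h11 : b ^ i * (1 - 1 / N) ≤ b ^ i := by
    have : 0 ≤ b ^ i * (1 / N) := by positivity
    linarith
  rw [abs_le]
  have e : 1 / ((i : ℝ) + 1) * a ^ (i + 1) = a ^ (i + 1) / (i + 1) := by ring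
  constructor <;> simp only [e] <;> linarith

lemma logAsymp_sum_log_pow_mul_log_div_pow (i j : ℕ) :
    LogAsymp (fun x => ∑ n ∈ Icc 1 ⌊x⌋₊, Real.log n ^ i * Real.log (x / n) ^ j / n)
      ((i.factorial : ℝ) * j.factorial / (i + j + 1).factorial) (i + j) := by
  induction j generalizing i with
  | zero =>
    convert logAsymp_sum_log_pow_div i using 1
    · simp
    · rw [Nat.factorial_succ]
      have := i.factorial_pos
      simp
      field_simp
    · simp
  | succ j ih =>
    obtain ⟨C, hC, h⟩ := ih i
    obtain ⟨D, hD, h'⟩ := ih (i + 1)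
    refine ⟨C + D, by positivity, fun x hx => ?_⟩
    have e1 : ∑ n ∈ Icc 1 ⌊x⌋₊, Real.log n ^ i * Real.log (x / n) ^ (j + 1) / n =
        Real.log x * ∑ n ∈ Icc 1 ⌊x⌋₊, Real.log n ^ i * Real.log (x / n) ^ j / n -
        ∑ n ∈ Icc 1 ⌊x⌋₊, Real.log n ^ (i + 1) * Real.log (x / n) ^ j / n := by
      rw [Finset.mul_sum, ← Finset.sum_sub_distrib]
      refine Finset.sum_congr rfl fun n hn => ?_
      have hn0 : (n : ℝ) ≠ 0 := by
        have := (Finset.mem_Icc.1 hn).1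
        positivity
      rw [pow_succ (Real.log (x / n)), Real.log_div (by linarith) hn0]
      ring
    have e2 : (i.factorial : ℝ) * (j + 1).factorial / (i + (j + 1) + 1).factorial =
        (i.factorial : ℝ) * j.factorial / (i + j + 1).factorial -
        ((i + 1).factorial : ℝ) * j.factorial / (i + 1 + j + 1).factorial := by
      rw [show i + (j + 1) + 1 = (i + j + 1) + 1 by ring, show i + 1 + j + 1 = (i + j + 1) + 1 by ring]
      rw [Nat.factorial_succ (i + j + 1), Nat.factorial_succ j, Nat.factorial_succ i]
      have := (i + j + 1).factorial_pos
      push_cast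
      field_simp
      ring
    have hl : 0 ≤ Real.log x := Real.log_nonneg hx
    specialize h x hx
    specialize h' x hx
    simp only [e1, e2]
    rw [show i + 1 + j = i + (j + 1) by ring] at h'
    set l := Real.log x
    set A := ∑ n ∈ Icc 1 ⌊x⌋₊, Real.log n ^ i * Real.log (x / n) ^ j / n
    set B := ∑ n ∈ Icc 1 ⌊x⌋₊, Real.log n ^ (i + 1) * Real.log (x / n) ^ j / n
    rw [show i + (j + 1) + 1 = i + 1 + j + 1 by ring] at h' ⊢
    set β : ℝ := (i.factorial : ℝ) * j.factorial / (i + j + 1).factorial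
    set γ : ℝ := ((i + 1).factorial : ℝ) * j.factorial / (i + 1 + j + 1).factorial
    have h3 : |l * (A - β * l ^ (i + j + 1))| ≤ C * (1 + l) ^ (i + (j + 1)) := by
      rw [abs_mul, abs_of_nonneg hl]
      calc l * _ ≤ (1 + l) * (C * (1 + l) ^ (i + j)) := by gcongr; linarith
        _ = _ := by ring
    calc |l * A - B - (β - γ) * l ^ (i + 1 + j + 1)|
        = |l * (A - β * l ^ (i + j + 1)) - (B - γ * l ^ (i + 1 + j + 1))| := by
          congr 1; ring
      _ ≤ _ := abs_sub _ _
      _ ≤ _ := by rw [add_mul]; exact add_le_add h3 h'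

lemma sum_one_div_le_one_add_log {x : ℝ} (hx : 1 ≤ x) :
    ∑ n ∈ Icc 1 ⌊x⌋₊, 1 / (n : ℝ) ≤ 1 + Real.log x := by
  have := harmonic_floor_le_one_add_log x hx
  rw [harmonic_eq_sum_Icc] at this
  push_cast at this
  simpa using this

lemma LogAsymp.convolve {G : ℝ → ℝ} {c : ℝ} {m : ℕ} (hG : LogAsymp G c m) (i : ℕ) :
    LogAsymp (fun x => ∑ n ∈ Icc 1 ⌊x⌋₊, Real.log n ^ i / n * G (x / n))
      (c * ((i.factorial : ℝ) * (m + 1).factorial / (i + (m + 1) + 1).factorial))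
      (i + (m + 1)) := by
  obtain ⟨C, hC, hG⟩ := hG
  obtain ⟨D, hD, h⟩ := logAsymp_sum_log_pow_mul_log_div_pow i (m + 1)
  refine ⟨C + |c| * D, by positivity, fun x hx => ?_⟩
  specialize h x hx
  have hl : 0 ≤ Real.log x := Real.log_nonneg hx
  set S := ∑ n ∈ Icc 1 ⌊x⌋₊, Real.log n ^ i * Real.log (x / n) ^ (m + 1) / n
  set β := (i.factorial : ℝ) * (m + 1).factorial / (i + (m + 1) + 1).factorial
  have h1 : |∑ n ∈ Icc 1 ⌊x⌋₊, Real.log n ^ i / n * G (x / n) - c * S| ≤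
      C * (1 + Real.log x) ^ (i + (m + 1)) := by
    rw [Finset.mul_sum, ← Finset.sum_sub_distrib]
    refine (Finset.abs_sum_le_sum_abs _ _).trans ?_
    calc _ ≤ ∑ n ∈ Icc 1 ⌊x⌋₊, C * (1 + Real.log x) ^ (i + m) * (1 / (n : ℝ)) := by
          refine Finset.sum_le_sum fun n hn => ?_
          obtain ⟨hn1, hn2⟩ := Finset.mem_Icc.1 hn
          have hn0 : (1 : ℝ) ≤ n := by exact_mod_cast hn1
          have hnx : (n : ℝ) ≤ x := (Nat.le_floor_iff (by linarith)).1 hn2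
          have hxn : 1 ≤ x / n := by rw [le_div_iff₀ (by linarith)]; linarith
          have hxn' : x / n ≤ x := div_le_self (by linarith) hn0
          have hln : 0 ≤ Real.log n := Real.log_natCast_nonneg n
          have hlnx : Real.log n ≤ 1 + Real.log x := by
            linarith [Real.log_le_log (by linarith) hnx]
          have hlxn : 0 ≤ Real.log (x / n) := Real.log_nonneg hxn
          have hlxn' := Real.log_le_log (by linarith) hxn'
          rw [show Real.log n ^ i / n * G (x / n) - c * (Real.log n ^ i * Real.log (x / n) ^ (m + 1) / n)
            = Real.log n ^ i * (1 / n) * (G (x / n) - c * Real.log (x / n) ^ (m + 1)) by ring, abs_mul,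
            abs_of_nonneg (by positivity)]
          calc _ ≤ (1 + Real.log x) ^ i * (1 / n) * (C * (1 + Real.log x) ^ m) := by
                gcongr
                exact (hG _ hxn).trans (by gcongr)
            _ = _ := by ring
      _ ≤ C * (1 + Real.log x) ^ (i + m) * (1 + Real.log x) := by
          rw [← Finset.mul_sum]
          gcongr
          exact sum_one_div_le_one_add_log hx
      _ = _ := by ring
  have h2 : |c * (S - β * Real.log x ^ (i + (m + 1) + 1))| ≤
      |c| * (D * (1 + Real.log x) ^ (i + (m + 1))) := by
    rw [abs_mul]
    gcongr
  set L := Real.log x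
  calc _ = |(∑ n ∈ Icc 1 ⌊x⌋₊, Real.log n ^ i / n * G (x / n) - c * S) +
        c * (S - β * L ^ (i + (m + 1) + 1))| := by congr 1; ring
    _ ≤ _ := abs_add_le _ _
    _ ≤ _ := add_le_add h1 h2
    _ = _ := by ring

/-- Quadruples of positive integers `(e, f, g, h)` with `e f g h ≤ N`. -/
def prodQuads (N : ℕ) : Finset (ℕ × ℕ × ℕ × ℕ) :=
  (Icc 1 N ×ˢ Icc 1 N ×ˢ Icc 1 N ×ˢ Icc 1 N).filter
    fun q => q.1 * q.2.1 * q.2.2.1 * q.2.2.2 ≤ N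

lemma mem_prodQuads {N e f g h : ℕ} :
    (e, f, g, h) ∈ prodQuads N ↔
      0 < e ∧ 0 < f ∧ 0 < g ∧ 0 < h ∧ e * f * g * h ≤ N := by
  simp only [prodQuads, Finset.mem_filter, Finset.mem_product, Finset.mem_Icc]
  constructor
  · rintro ⟨⟨⟨he, -⟩, ⟨hf, -⟩, ⟨hg, -⟩, hh, -⟩, hN⟩
    exact ⟨he, hf, hg, hh, hN⟩
  · rintro ⟨he, hf, hg, hh, hN⟩
    have h1 : e ≤ e * f * g * h := by
      rw [mul_assoc, mul_assoc]; exact Nat.le_mul_of_pos_right _ (by positivity)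
    have h2 : f ≤ e * f * g * h := by
      rw [show e * f * g * h = f * (e * g * h) by ring]
      exact Nat.le_mul_of_pos_right _ (by positivity)
    have h3 : g ≤ e * f * g * h := by
      rw [show e * f * g * h = g * (e * f * h) by ring]
      exact Nat.le_mul_of_pos_right _ (by positivity)
    have h4 : h ≤ e * f * g * h := Nat.le_mul_of_pos_left _ (by positivity)
    refine ⟨⟨⟨he, ?_⟩, ⟨hf, ?_⟩, ⟨hg, ?_⟩, hh, ?_⟩, hN⟩ <;> omega

lemma sum_prodQuads (N : ℕ) (F : ℕ → ℕ → ℕ → ℕ → ℝ) :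
    ∑ q ∈ prodQuads N, F q.1 q.2.1 q.2.2.1 q.2.2.2 =
      ∑ e ∈ Icc 1 N, ∑ f ∈ Icc 1 (N / e), ∑ g ∈ Icc 1 (N / e / f),
        ∑ h ∈ Icc 1 (N / e / f / g), F e f g h := by
  simp only [Finset.sum_sigma']
  refine Finset.sum_nbij' (fun q => ⟨q.1, q.2.1, q.2.2.1, q.2.2.2⟩)
    (fun s => (s.1, s.2.1, s.2.2.1, s.2.2.2)) ?_ ?_ ?_ ?_ ?_
  · rintro ⟨e, f, g, h⟩ hq
    obtain ⟨he, hf, hg, hh, hN⟩ := mem_prodQuads.1 hq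
    simp only [Finset.mem_sigma, Finset.mem_Icc, Nat.div_div_eq_div_mul]
    have h1 : e * f * g ≤ e * f * g * h := Nat.le_mul_of_pos_right _ hh
    have h2 : e * f ≤ e * f * g := Nat.le_mul_of_pos_right _ hg
    have h3 : e ≤ e * f := Nat.le_mul_of_pos_right _ hf
    refine ⟨⟨he, by omega⟩, ⟨hf, ?_⟩, ⟨hg, ?_⟩, hh, ?_⟩ <;>
      rw [Nat.le_div_iff_mul_le (by positivity)] <;> [rw [mul_comm f]; rw [mul_comm g]; rw [mul_comm h]] <;>
      omega
  · rintro ⟨e, f, g, h⟩ hq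
    simp only [Finset.mem_sigma, Finset.mem_Icc, Nat.div_div_eq_div_mul] at hq
    obtain ⟨⟨he, -⟩, ⟨hf, -⟩, ⟨hg, -⟩, hh, hN⟩ := hq
    refine mem_prodQuads.2 ⟨he, hf, hg, hh, ?_⟩
    rw [Nat.le_div_iff_mul_le (by positivity)] at hN
    linarith
  all_goals simp

lemma sum_divisorsAntidiagonal_sq (N : ℕ) (F : ℕ → ℕ → ℕ → ℕ → ℝ) :
    ∑ n ∈ Icc 1 N, ∑ x ∈ n.divisorsAntidiagonal, ∑ y ∈ n.divisorsAntidiagonal,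
        F x.1 x.2 y.1 y.2 =
      ∑ q ∈ prodQuads N with q.2.1.Coprime q.2.2.1,
        F (q.1 * q.2.1) (q.2.2.1 * q.2.2.2) (q.1 * q.2.2.1) (q.2.1 * q.2.2.2) := by
  simp only [← Finset.sum_product', Finset.sum_sigma']
  symm
  refine Finset.sum_bij (fun q _ => ⟨q.1 * q.2.1 * q.2.2.1 * q.2.2.2,
    ((q.1 * q.2.1, q.2.2.1 * q.2.2.2), (q.1 * q.2.2.1, q.2.1 * q.2.2.2))⟩) ?_ ?_ ?_ ?_
  · rintro ⟨e, f, g, h⟩ hq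
    obtain ⟨hq, -⟩ := Finset.mem_filter.1 hq
    obtain ⟨he, hf, hg, hh, hN⟩ := mem_prodQuads.1 hq
    have : 0 < e * f * g * h := by positivity
    simp only [Finset.mem_sigma, Finset.mem_Icc, Finset.mem_product,
      Nat.mem_divisorsAntidiagonal]
    refine ⟨⟨by omega, hN⟩, ⟨by ring, by omega⟩, by ring, by omega⟩
  · rintro ⟨e, f, g, h⟩ hq ⟨e', f', g', h'⟩ hq' heq
    obtain ⟨hq, hc⟩ := Finset.mem_filter.1 hq
    obtain ⟨he, hf, hg, hh, -⟩ := mem_prodQuads.1 hq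
    obtain ⟨hq', hc'⟩ := Finset.mem_filter.1 hq'
    obtain ⟨he', hf', hg', hh', -⟩ := mem_prodQuads.1 hq'
    simp only [Sigma.mk.injEq, heq_eq_eq, Prod.mk.injEq] at heq
    obtain ⟨-, ⟨h1, h2⟩, h3, h4⟩ := heq
    have hee : e = e' := by
      have h5 : (e * f).gcd (e * g) = (e' * f').gcd (e' * g') := by rw [h1, h3]
      rwa [Nat.gcd_mul_left, Nat.gcd_mul_left, hc.gcd_eq_one, hc'.gcd_eq_one, mul_one,
        mul_one] at h5
    subst hee
    have hff := Nat.eq_of_mul_eq_mul_left he h1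
    have hgg := Nat.eq_of_mul_eq_mul_left he h3
    subst hff
    subst hgg
    rw [Nat.eq_of_mul_eq_mul_left hg h2]
  · rintro ⟨n, ⟨a, b⟩, c, d⟩ hq
    simp only [Finset.mem_sigma, Finset.mem_Icc, Finset.mem_product,
      Nat.mem_divisorsAntidiagonal] at hq
    obtain ⟨⟨hn, hN⟩, ⟨hab, -⟩, hcd, -⟩ := hq
    have ha : 0 < a := by rcases Nat.eq_zero_or_pos a with rfl | h <;> omega
    obtain ⟨e, f, g, he, hfg, rfl, rfl⟩ : ∃ e f g, 0 < e ∧ f.Coprime g ∧ a = e * f ∧ c = e * g := by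
      obtain ⟨g, e, f, he, hfg, h1, h2⟩ := Nat.exists_coprime' (Nat.gcd_pos_of_pos_left c ha)
      exact ⟨g, e, f, he, hfg, by rw [h1, mul_comm], by rw [h2, mul_comm]⟩
    have hf : 0 < f := Nat.pos_of_mul_pos_left ha
    have h1 : f * b = g * d := by
      apply Nat.eq_of_mul_eq_mul_left he
      rw [← mul_assoc, ← mul_assoc, hab, hcd]
    obtain ⟨h, rfl⟩ : g ∣ b := hfg.symm.dvd_of_dvd_mul_left ⟨d, h1⟩
    have hgh : 0 < e * f * (g * h) := by omega
    have hg : 0 < g := by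
      rcases Nat.eq_zero_or_pos g with rfl | h' <;> [simp at hgh; assumption]
    have hh : 0 < h := by
      rcases Nat.eq_zero_or_pos h with rfl | h' <;> [simp at hgh; assumption]
    have hd : d = f * h := by
      apply Nat.eq_of_mul_eq_mul_left hg
      rw [← h1]; ring
    subst hd
    refine ⟨(e, f, g, h), Finset.mem_filter.2 ⟨mem_prodQuads.2 ⟨he, hf, hg, hh, ?_⟩, hfg⟩, ?_⟩
    · rw [mul_assoc (e * f), hab]; exact hN
    · simp [← hab, mul_assoc]
  · intros; rfl

open ArithmeticFunction in
lemma ite_coprime_eq_sum_moebius {N f g : ℕ} (hf : 0 < f) (hfN : f ≤ N) :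
    (if f.Coprime g then (1 : ℝ) else 0) =
      ∑ k ∈ Icc 1 N, if k ∣ f ∧ k ∣ g then (moebius k : ℝ) else 0 := by
  have h1 : ∑ k ∈ (f.gcd g).divisors, moebius k = if f.gcd g = 1 then (1 : ℤ) else 0 := by
    rw [← coe_mul_zeta_apply, moebius_mul_coe_zeta, one_apply]
  rw [← Finset.sum_filter]
  have h2 : (Icc 1 N).filter (fun k => k ∣ f ∧ k ∣ g) = (f.gcd g).divisors := by
    ext k
    simp only [Finset.mem_filter, Finset.mem_Icc, Nat.mem_divisors, Nat.dvd_gcd_iff]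
    constructor
    · rintro ⟨-, h⟩
      exact ⟨h, (Nat.gcd_pos_of_pos_left g hf).ne'⟩
    · rintro ⟨h, -⟩
      exact ⟨⟨Nat.pos_of_dvd_of_pos h.1 hf, (Nat.le_of_dvd hf h.1).trans hfN⟩, h⟩
  rw [h2]
  simp only [Nat.coprime_iff_gcd_eq_one]
  exact_mod_cast h1.symm

open ArithmeticFunction in
lemma sum_coprime_prodQuads (N : ℕ) (F : ℕ → ℕ → ℕ → ℕ → ℝ) :
    ∑ q ∈ prodQuads N with q.2.1.Coprime q.2.2.1, F q.1 q.2.1 q.2.2.1 q.2.2.2 =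
      ∑ k ∈ Icc 1 N, (moebius k : ℝ) *
        ∑ q ∈ prodQuads (N / (k * k)), F q.1 (k * q.2.1) (k * q.2.2.1) q.2.2.2 := by
  have h1 : ∀ q ∈ prodQuads N, (if q.2.1.Coprime q.2.2.1 then F q.1 q.2.1 q.2.2.1 q.2.2.2 else 0) =
      ∑ k ∈ Icc 1 N, (moebius k : ℝ) *
        if k ∣ q.2.1 ∧ k ∣ q.2.2.1 then F q.1 q.2.1 q.2.2.1 q.2.2.2 else 0 := by
    intro q hq
    have hq' : q.2.1 ∈ Icc 1 N := by
      simp only [prodQuads, Finset.mem_filter, Finset.mem_product] at hq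
      exact hq.1.2.1
    obtain ⟨hf, hfN⟩ := Finset.mem_Icc.1 hq'
    rw [← one_mul (F _ _ _ _), ← zero_mul (F q.1 q.2.1 q.2.2.1 q.2.2.2), ← ite_mul,
      ite_coprime_eq_sum_moebius hf hfN, Finset.sum_mul]
    refine Finset.sum_congr rfl fun k _ => ?_
    split_ifs <;> simp
  rw [Finset.sum_filter, Finset.sum_congr rfl h1, Finset.sum_comm]
  refine Finset.sum_congr rfl fun k hk => ?_
  have hk0 : 0 < k := (Finset.mem_Icc.1 hk).1
  rw [← Finset.mul_sum, ← Finset.sum_filter]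
  congr 1
  symm
  refine Finset.sum_nbij' (fun q => (q.1, k * q.2.1, k * q.2.2.1, q.2.2.2))
    (fun q => (q.1, q.2.1 / k, q.2.2.1 / k, q.2.2.2)) ?_ ?_ ?_ ?_ ?_
  · rintro ⟨e, f, g, h⟩ hq
    obtain ⟨he, hf, hg, hh, hN⟩ := mem_prodQuads.1 hq
    rw [Nat.le_div_iff_mul_le (by positivity)] at hN
    refine Finset.mem_filter.2 ⟨mem_prodQuads.2 ⟨he, by positivity, by positivity, hh, ?_⟩, by simp⟩
    linarith
  · rintro ⟨e, f, g, h⟩ hq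
    obtain ⟨hq, ⟨f, rfl⟩, ⟨g, rfl⟩⟩ := Finset.mem_filter.1 hq
    obtain ⟨he, hf, hg, hh, hN⟩ := mem_prodQuads.1 hq
    simp only [Nat.mul_div_cancel_left _ hk0]
    refine mem_prodQuads.2 ⟨he, Nat.pos_of_mul_pos_left hf, Nat.pos_of_mul_pos_left hg, hh, ?_⟩
    rw [Nat.le_div_iff_mul_le (by positivity)]
    linarith
  · rintro ⟨e, f, g, h⟩ hq
    simp [hk0]
  · rintro ⟨e, f, g, h⟩ hq
    obtain ⟨hq, hf, hg⟩ := Finset.mem_filter.1 hq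
    simp only [Nat.mul_div_cancel' hf, Nat.mul_div_cancel' hg]
  · intros; rfl

lemma sum_prodQuads_one_div_le {x : ℝ} (hx : 1 ≤ x) :
    ∑ q ∈ prodQuads ⌊x⌋₊, 1 / ((q.1 : ℝ) * q.2.1 * q.2.2.1 * q.2.2.2) ≤
      (1 + Real.log x) ^ 4 := by
  calc _ ≤ ∑ q ∈ Icc 1 ⌊x⌋₊ ×ˢ Icc 1 ⌊x⌋₊ ×ˢ Icc 1 ⌊x⌋₊ ×ˢ Icc 1 ⌊x⌋₊,
        1 / (q.1 : ℝ) * (1 / q.2.1 * (1 / q.2.2.1 * (1 / q.2.2.2))) := by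
        refine (Finset.sum_le_sum_of_subset_of_nonneg (Finset.filter_subset _ _)
          fun _ _ _ => by positivity).trans (le_of_eq ?_)
        refine Finset.sum_congr rfl fun q _ => ?_
        simp only [one_div, mul_inv]
        ring
    _ = (∑ n ∈ Icc 1 ⌊x⌋₊, 1 / (n : ℝ)) ^ 4 := by
        simp only [Finset.sum_product, ← Finset.mul_sum, ← Finset.sum_mul]
        ring
    _ ≤ _ := by
        gcongr
        exact sum_one_div_le_one_add_log hx

lemma logAsymp_prodQuads (i j k l : ℕ) :
    LogAsymp (fun x => ∑ q ∈ prodQuads ⌊x⌋₊,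
        Real.log q.1 ^ i * Real.log q.2.1 ^ j * Real.log q.2.2.1 ^ k * Real.log q.2.2.2 ^ l /
          ((q.1 : ℝ) * q.2.1 * q.2.2.1 * q.2.2.2))
      ((i.factorial : ℝ) * j.factorial * k.factorial * l.factorial / (i + j + k + l + 4).factorial)
      (i + j + k + l + 3) := by
  convert (((logAsymp_sum_log_pow_div l).convolve k).convolve j).convolve i using 1
  · funext x
    rw [sum_prodQuads ⌊x⌋₊ (fun a b c d => Real.log a ^ i * Real.log b ^ j * Real.log c ^ k *
      Real.log d ^ l / ((a : ℝ) * b * c * d))]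
    simp only [Nat.floor_div_natCast, Finset.mul_sum]
    refine Finset.sum_congr rfl fun e _ => Finset.sum_congr rfl fun f _ =>
      Finset.sum_congr rfl fun g _ => Finset.sum_congr rfl fun h _ => ?_
    ring
  · rw [show i + (j + (k + (l + 1) + 1) + 1) + 1 = i + j + k + l + 4 by ring,
      Nat.factorial_succ l]
    have h1 := (k + (l + 1) + 1).factorial_ne_zero
    have h2 := (j + (k + (l + 1) + 1) + 1).factorial_ne_zero
    push_cast
    field_simp
  · ring

open ArithmeticFunction in
lemma hasSum_moebius_div_sq :
    HasSum (fun k : ℕ => (moebius k : ℝ) / (k : ℝ) ^ 2) (6 / Real.pi ^ 2) := by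
  have h2 : 1 < (2 : ℂ).re := by norm_num
  have h := (LSeriesSummable_moebius_iff.mpr h2).LSeriesHasSum
  have hL := LSeries_zeta_mul_Lseries_moebius h2
  rw [LSeries_zeta_eq_riemannZeta h2, riemannZeta_two] at hL
  have hpi : (Real.pi : ℂ) ≠ 0 := by exact_mod_cast Real.pi_ne_zero
  have hv : LSeries (fun n => ((moebius n : ℤ) : ℂ)) 2 = ((6 / Real.pi ^ 2 : ℝ) : ℂ) := by
    push_cast
    field_simp at hL ⊢
    linear_combination hL
  rw [hv] at h
  unfold LSeriesHasSum at h
  rw [← Complex.hasSum_ofReal]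
  convert h using 2 with k
  rcases eq_or_ne k 0 with rfl | hk
  · simp
  · rw [LSeries.term_of_ne_zero hk]
    push_cast
    norm_cast

lemma summable_one_add_log_div_sq :
    Summable fun k : ℕ => (1 + Real.log k) / (k : ℝ) ^ 2 := by
  refine Summable.of_nonneg_of_le (f := fun k : ℕ => 3 * (1 / (k : ℝ) ^ (3 / 2 : ℝ)))
    (fun k => ?_) (fun k => ?_)
    ((Real.summable_one_div_nat_rpow.2 (by norm_num)).mul_left 3)
  · have := Real.log_natCast_nonneg k
    positivity
  · rcases Nat.eq_zero_or_pos k with rfl | hk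
    · simp
    have hk1 : (1 : ℝ) ≤ k := by exact_mod_cast hk
    have h1 : Real.log k ≤ (k : ℝ) ^ (1 / 2 : ℝ) / (1 / 2) :=
      Real.log_le_rpow_div (by positivity) (by norm_num)
    have h2 : (1 : ℝ) ≤ (k : ℝ) ^ (1 / 2 : ℝ) := Real.one_le_rpow hk1 (by norm_num)
    have h3 : (k : ℝ) ^ 2 = (k : ℝ) ^ (1 / 2 : ℝ) * (k : ℝ) ^ (3 / 2 : ℝ) := by
      rw [← Real.rpow_add (by positivity), ← Real.rpow_natCast]
      norm_num
    rw [h3, mul_one_div, div_le_div_iff₀ (by positivity) (by positivity)]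
    calc (1 + Real.log k) * (k : ℝ) ^ (3 / 2 : ℝ)
        ≤ (3 * (k : ℝ) ^ (1 / 2 : ℝ)) * (k : ℝ) ^ (3 / 2 : ℝ) := by gcongr; linarith
      _ = _ := by ring

/-- The logarithmically weighted average of `∑ W (log a, log b, log c, log d)` over `ab = cd = n`,
from the asymptotics of the corresponding unrestricted sum over quadruples. -/
theorem logAsymp_sum_divisorsAntidiagonal_sq {W : ℝ → ℝ → ℝ → ℝ → ℝ} {c : ℝ} {r : ℕ}
    (hW0 : LogAsymp (fun x => ∑ q ∈ prodQuads ⌊x⌋₊,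
      W (Real.log q.1 + Real.log q.2.1) (Real.log q.2.2.1 + Real.log q.2.2.2)
        (Real.log q.1 + Real.log q.2.2.1) (Real.log q.2.1 + Real.log q.2.2.2) /
          ((q.1 : ℝ) * q.2.1 * q.2.2.1 * q.2.2.2)) c (r + 4))
    (hW1 : ∃ C, 0 ≤ C ∧ ∀ l κ x y z w : ℝ, 0 ≤ κ → κ ≤ l → 0 ≤ x → x ≤ 2 * l → 0 ≤ y → y ≤ 2 * l →
      0 ≤ z → z ≤ 2 * l → 0 ≤ w → w ≤ 2 * l →
      |W (x + κ) (y + κ) (z + κ) (w + κ) - W x y z w| ≤ C * κ * l ^ r) :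
    LogAsymp (fun t => ∑ n ∈ Icc 1 ⌊t⌋₊,
      (∑ x ∈ n.divisorsAntidiagonal, ∑ y ∈ n.divisorsAntidiagonal,
        W (Real.log x.1) (Real.log x.2) (Real.log y.1) (Real.log y.2)) / n)
      (6 / Real.pi ^ 2 * c) (r + 4) := by
  obtain ⟨D, hD, hW0⟩ := hW0
  obtain ⟨C, hC, hW1⟩ := hW1
  set E := C + D + 2 * |c| * (r + 5) with hE
  have hE0 : 0 ≤ E := by positivity
  refine ⟨E * ∑' k : ℕ, (1 + Real.log k) / (k : ℝ) ^ 2,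
    mul_nonneg hE0 (tsum_nonneg fun k => by have := Real.log_natCast_nonneg k; positivity),
    fun t ht => ?_⟩
  have hl : 0 ≤ Real.log t := Real.log_nonneg ht
  set l := Real.log t with hl_def
  set N := ⌊t⌋₊ with hN
  set S : ℕ → ℝ := fun k => ∑ q ∈ prodQuads (N / (k * k)),
      W (Real.log q.1 + Real.log q.2.1 + Real.log k) (Real.log q.2.2.1 + Real.log q.2.2.2 + Real.log k)
        (Real.log q.1 + Real.log q.2.2.1 + Real.log k) (Real.log q.2.1 + Real.log q.2.2.2 + Real.log k) /
          ((q.1 : ℝ) * q.2.1 * q.2.2.1 * q.2.2.2) with hS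
  have h1 : ∑ n ∈ Icc 1 N,
      (∑ x ∈ n.divisorsAntidiagonal, ∑ y ∈ n.divisorsAntidiagonal,
        W (Real.log x.1) (Real.log x.2) (Real.log y.1) (Real.log y.2)) / n =
      ∑ k ∈ Icc 1 N, (ArithmeticFunction.moebius k : ℝ) / (k : ℝ) ^ 2 * S k := by
    calc _ = ∑ n ∈ Icc 1 N, ∑ x ∈ n.divisorsAntidiagonal, ∑ y ∈ n.divisorsAntidiagonal,
        W (Real.log x.1) (Real.log x.2) (Real.log y.1) (Real.log y.2) / ((x.1 : ℝ) * x.2) := by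
          refine Finset.sum_congr rfl fun n _ => ?_
          rw [Finset.sum_div]
          refine Finset.sum_congr rfl fun x hx => ?_
          rw [Finset.sum_div, ← (Nat.mem_divisorsAntidiagonal.1 hx).1, Nat.cast_mul]
      _ = _ := by
          rw [sum_divisorsAntidiagonal_sq N (fun a b c d =>
            W (Real.log a) (Real.log b) (Real.log c) (Real.log d) / ((a : ℝ) * b)),
            sum_coprime_prodQuads N (fun e f g h =>
            W (Real.log (e * f : ℕ)) (Real.log (g * h : ℕ)) (Real.log (e * g : ℕ))
              (Real.log (f * h : ℕ)) / (((e * f : ℕ) : ℝ) * (g * h : ℕ)))]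
          refine Finset.sum_congr rfl fun k hk => ?_
          have hk0 : (k : ℝ) ≠ 0 := by
            have := (Finset.mem_Icc.1 hk).1
            positivity
          rw [hS, div_mul_eq_mul_div, mul_div_assoc, Finset.sum_div]
          congr 1
          refine Finset.sum_congr rfl ?_
          rintro ⟨e, f, g, h⟩ hq
          obtain ⟨he, hf, hg, hh, -⟩ := mem_prodQuads.1 hq
          have he' : (e : ℝ) ≠ 0 := by positivity
          have hf' : (f : ℝ) ≠ 0 := by positivity
          have hg' : (g : ℝ) ≠ 0 := by positivity
          have hh' : (h : ℝ) ≠ 0 := by positivity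
          push_cast
          rw [Real.log_mul he' (by positivity), Real.log_mul he' (by positivity),
            Real.log_mul (by positivity) hh', Real.log_mul (by positivity) hh',
            Real.log_mul hk0 hf', Real.log_mul hk0 hg', div_div]
          congr 1
          · congr 1 <;> ring
          · ring
  have h2 : ∀ k : ℕ, 1 ≤ k → |S k - c * l ^ (r + 5)| ≤ E * (1 + Real.log k) * (1 + l) ^ (r + 4) := by
    intro k hk
    have hκ : 0 ≤ Real.log k := Real.log_natCast_nonneg k
    set κ := Real.log k with hκ_def
    have hk0 : (0 : ℝ) < k := by exact_mod_cast hk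
    have hκ1 : 1 ≤ 1 + κ := by linarith
    have hp1 : 0 ≤ (1 + l) ^ (r + 4) := by positivity
    have hlp : l ^ (r + 4) ≤ (1 + l) ^ (r + 4) := pow_le_pow_left₀ hl (by linarith) _
    by_cases hkt : ((k * k : ℕ) : ℝ) ≤ t
    · have hkk : (0 : ℝ) < ((k * k : ℕ) : ℝ) := by positivity
      have hx : 1 ≤ t / ((k * k : ℕ) : ℝ) := by rwa [one_le_div hkk]
      have hfl : ⌊t / ((k * k : ℕ) : ℝ)⌋₊ = N / (k * k) := Nat.floor_div_natCast _ _
      have hlx : Real.log (t / ((k * k : ℕ) : ℝ)) = l - 2 * κ := by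
        rw [Real.log_div (by positivity) hkk.ne']
        push_cast
        rw [Real.log_mul hk0.ne' hk0.ne']
        ring
      have h3 := hW0 _ hx
      beta_reduce at h3
      have h4 := sum_prodQuads_one_div_le hx
      have hlam := Real.log_nonneg hx
      rw [hlx] at h3 h4 hlam
      rw [hfl] at h3 h4
      set S0 := ∑ q ∈ prodQuads (N / (k * k)),
        W (Real.log q.1 + Real.log q.2.1) (Real.log q.2.2.1 + Real.log q.2.2.2)
          (Real.log q.1 + Real.log q.2.2.1) (Real.log q.2.1 + Real.log q.2.2.2) /
            ((q.1 : ℝ) * q.2.1 * q.2.2.1 * q.2.2.2)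
      have h5 : |S k - S0| ≤ C * (1 + κ) * (1 + l) ^ (r + 4) := by
        rw [← Finset.sum_sub_distrib]
        refine (Finset.abs_sum_le_sum_abs _ _).trans ?_
        calc _ ≤ ∑ q ∈ prodQuads (N / (k * k)), C * κ * l ^ r *
              (1 / ((q.1 : ℝ) * q.2.1 * q.2.2.1 * q.2.2.2)) := by
              refine Finset.sum_le_sum ?_
              rintro ⟨e, f, g, h⟩ hq
              have hmem := hq
              simp only [prodQuads, Finset.mem_filter, Finset.mem_product, Finset.mem_Icc] at hmem
              have hb : ∀ a : ℕ, 1 ≤ a → a ≤ N / (k * k) → Real.log a ≤ l := by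
                intro a ha haN
                refine Real.log_le_log (by exact_mod_cast ha) ?_
                exact (Nat.le_floor_iff (by linarith)).1 (haN.trans (Nat.div_le_self _ _))
              have he := hb e hmem.1.1.1 hmem.1.1.2
              have hf := hb f hmem.1.2.1.1 hmem.1.2.1.2
              have hg := hb g hmem.1.2.2.1.1 hmem.1.2.2.1.2
              have hh := hb h hmem.1.2.2.2.1 hmem.1.2.2.2.2
              have he' := Real.log_natCast_nonneg e
              have hf' := Real.log_natCast_nonneg f
              have hg' := Real.log_natCast_nonneg g
              have hh' := Real.log_natCast_nonneg h
              simp only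
              rw [← sub_div, abs_div, abs_of_nonneg (by positivity : (0 : ℝ) ≤ e * f * g * h),
                ← mul_one_div]
              gcongr
              apply hW1 <;> linarith
          _ ≤ C * κ * l ^ r * (1 + (l - 2 * κ)) ^ 4 := by
              rw [← Finset.mul_sum]
              gcongr
          _ ≤ C * (1 + κ) * (1 + l) ^ r * (1 + l) ^ 4 := by
              gcongr <;> linarith
          _ = _ := by ring
      have h6 : |S0 - c * (l - 2 * κ) ^ (r + 5)| ≤ D * (1 + κ) * (1 + l) ^ (r + 4) := by
        calc _ ≤ D * (1 + (l - 2 * κ)) ^ (r + 4) := h3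
          _ ≤ D * 1 * (1 + l) ^ (r + 4) := by rw [mul_one]; gcongr; linarith
          _ ≤ _ := by gcongr
      have h7 : |c * (l - 2 * κ) ^ (r + 5) - c * l ^ (r + 5)| ≤
          2 * |c| * (r + 5) * (1 + κ) * (1 + l) ^ (r + 4) := by
        have h8 := pow_succ_sub_pow_succ_le hlam (by linarith : l - 2 * κ ≤ l) (r + 4)
        have h9 : (l - 2 * κ) ^ (r + 5) ≤ l ^ (r + 5) := pow_le_pow_left₀ hlam (by linarith) _
        rw [← mul_sub, abs_mul, abs_sub_comm, abs_of_nonneg (sub_nonneg.2 h9)]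
        calc _ ≤ |c| * (((r + 4 : ℕ) + 1) * (l - (l - 2 * κ)) * l ^ (r + 4)) := by gcongr
          _ = 2 * |c| * (r + 5) * κ * l ^ (r + 4) := by push_cast; ring
          _ ≤ _ := by gcongr; linarith
      calc |S k - c * l ^ (r + 5)|
          = |(S k - S0) + (S0 - c * (l - 2 * κ) ^ (r + 5)) +
              (c * (l - 2 * κ) ^ (r + 5) - c * l ^ (r + 5))| := by congr 1; ring
        _ ≤ _ := abs_add_three _ _ _
        _ ≤ _ := add_le_add (add_le_add h5 h6) h7
        _ = _ := by rw [hE]; ring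
    · have hz : N / (k * k) = 0 := by
        apply Nat.div_eq_of_lt
        rw [hN, Nat.floor_lt (by linarith)]
        exact not_le.1 hkt
      have hS0 : S k = 0 := by
        rw [hS]
        simp only [hz]
        simp [prodQuads]
      have hlκ : l ≤ 2 * κ := by
        have : Real.log t ≤ Real.log ((k * k : ℕ) : ℝ) :=
          Real.log_le_log (by linarith) (not_le.1 hkt).le
        push_cast at this
        rw [Real.log_mul hk0.ne' hk0.ne'] at this
        linarith
      rw [hS0, zero_sub, abs_neg, abs_mul, abs_of_nonneg (pow_nonneg hl (r + 5))]
      calc |c| * l ^ (r + 5) = |c| * l * l ^ (r + 4) := by ring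
        _ ≤ |c| * (2 * (1 + κ)) * (1 + l) ^ (r + 4) := by gcongr; linarith
        _ = 2 * |c| * 1 * (1 + κ) * (1 + l) ^ (r + 4) := by ring
        _ ≤ E * (1 + κ) * (1 + l) ^ (r + 4) := by
          gcongr
          have : 2 * |c| * 1 ≤ 2 * |c| * (r + 5) := by
            gcongr
            linarith [(Nat.cast_nonneg r : (0 : ℝ) ≤ r)]
          rw [hE]
          linarith
  have h3 : HasSum (fun k : ℕ => (ArithmeticFunction.moebius k : ℝ) / (k : ℝ) ^ 2 * S k)
      (∑ k ∈ Icc 1 N, (ArithmeticFunction.moebius k : ℝ) / (k : ℝ) ^ 2 * S k) := by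
    apply hasSum_sum_of_ne_finset_zero
    intro k hk
    rcases Nat.eq_zero_or_pos k with rfl | hk0
    · simp
    have hkN : N < k := by
      by_contra h
      exact hk (Finset.mem_Icc.2 ⟨hk0, not_lt.1 h⟩)
    have hz : N / (k * k) = 0 := Nat.div_eq_of_lt (hkN.trans_le (Nat.le_mul_self k))
    have hS0 : S k = 0 := by
      rw [hS]
      simp only [hz]
      simp [prodQuads]
    rw [hS0, mul_zero]
  have h4 := h3.sub (hasSum_moebius_div_sq.mul_right (c * l ^ (r + 5)))
  have h5 := (summable_one_add_log_div_sq.hasSum.mul_left (E * (1 + l) ^ (r + 4)))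
  have h6 := h4.norm_le_of_bounded h5 fun k => by
    rcases Nat.eq_zero_or_pos k with rfl | hk0
    · simp
    rw [← mul_sub, Real.norm_eq_abs, abs_mul, abs_div, abs_of_nonneg (by positivity : (0 : ℝ) ≤ (k : ℝ) ^ 2)]
    have hm : |(ArithmeticFunction.moebius k : ℝ)| ≤ 1 := by
      exact_mod_cast ArithmeticFunction.abs_moebius_le_one
    calc _ ≤ 1 / (k : ℝ) ^ 2 * (E * (1 + Real.log k) * (1 + l) ^ (r + 4)) := by
          gcongr
          exact h2 k hk0
      _ = _ := by ring
  rw [Real.norm_eq_abs] at h6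
  beta_reduce
  rw [← hN, h1]
  refine le_trans (le_of_eq ?_) (h6.trans (le_of_eq ?_))
  · congr 1
    ring
  · ring

lemma sum_divisorsAntidiagonal_prime_mul {p n : ℕ} (hp : p.Prime) (hn : 0 < n) (f : ℕ → ℕ → ℝ) :
    ∑ x ∈ (p * n).divisorsAntidiagonal, f x.1 x.2 =
      ∑ x ∈ n.divisorsAntidiagonal, f (p * x.1) x.2 +
        ∑ x ∈ n.divisorsAntidiagonal, f x.1 (p * x.2) -
        if p ∣ n then ∑ x ∈ (n / p).divisorsAntidiagonal, f (p * x.1) (p * x.2) else 0 := by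
  have hp0 : 0 < p := hp.pos
  set s := (p * n).divisorsAntidiagonal
  have h1 : ∑ x ∈ s with p ∣ x.1, f x.1 x.2 = ∑ x ∈ n.divisorsAntidiagonal, f (p * x.1) x.2 := by
    symm
    refine Finset.sum_bij (fun x _ => (p * x.1, x.2)) ?_ ?_ ?_ ?_
    · rintro ⟨a, b⟩ h
      obtain ⟨rfl, h⟩ := Nat.mem_divisorsAntidiagonal.1 h
      refine Finset.mem_filter.2 ⟨Nat.mem_divisorsAntidiagonal.2 ⟨by ring, by positivity⟩, by simp⟩
    · rintro ⟨a, b⟩ - ⟨a', b'⟩ - h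
      simpa [hp0.ne'] using h
    · rintro ⟨a, b⟩ h
      obtain ⟨h, a, rfl⟩ := Finset.mem_filter.1 h
      obtain ⟨h, -⟩ := Nat.mem_divisorsAntidiagonal.1 h
      refine ⟨(a, b), Nat.mem_divisorsAntidiagonal.2 ⟨?_, hn.ne'⟩, rfl⟩
      exact Nat.eq_of_mul_eq_mul_left hp0 (by rw [← h]; ring)
    · intros; rfl
  have h2 : ∑ x ∈ s with p ∣ x.2, f x.1 x.2 = ∑ x ∈ n.divisorsAntidiagonal, f x.1 (p * x.2) := by
    symm
    refine Finset.sum_bij (fun x _ => (x.1, p * x.2)) ?_ ?_ ?_ ?_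
    · rintro ⟨a, b⟩ h
      obtain ⟨rfl, h⟩ := Nat.mem_divisorsAntidiagonal.1 h
      refine Finset.mem_filter.2 ⟨Nat.mem_divisorsAntidiagonal.2 ⟨by ring, by positivity⟩, by simp⟩
    · rintro ⟨a, b⟩ - ⟨a', b'⟩ - h
      simpa [hp0.ne'] using h
    · rintro ⟨a, b⟩ h
      obtain ⟨h, b, rfl⟩ := Finset.mem_filter.1 h
      obtain ⟨h, -⟩ := Nat.mem_divisorsAntidiagonal.1 h
      refine ⟨(a, b), Nat.mem_divisorsAntidiagonal.2 ⟨?_, hn.ne'⟩, rfl⟩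
      exact Nat.eq_of_mul_eq_mul_left hp0 (by rw [← h]; ring)
    · intros; rfl
  have h3 : ∑ x ∈ s with p ∣ x.1 ∧ p ∣ x.2, f x.1 x.2 =
      if p ∣ n then ∑ x ∈ (n / p).divisorsAntidiagonal, f (p * x.1) (p * x.2) else 0 := by
    split_ifs with hpn
    · obtain ⟨m, rfl⟩ := hpn
      rw [Nat.mul_div_cancel_left _ hp0]
      symm
      refine Finset.sum_bij (fun x _ => (p * x.1, p * x.2)) ?_ ?_ ?_ ?_
      · rintro ⟨a, b⟩ h
        obtain ⟨rfl, h⟩ := Nat.mem_divisorsAntidiagonal.1 h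
        refine Finset.mem_filter.2
          ⟨Nat.mem_divisorsAntidiagonal.2 ⟨by ring, by positivity⟩, by simp⟩
      · rintro ⟨a, b⟩ - ⟨a', b'⟩ - h
        simpa [hp0.ne'] using h
      · rintro ⟨a, b⟩ h
        obtain ⟨h, ⟨a, rfl⟩, b, rfl⟩ := Finset.mem_filter.1 h
        obtain ⟨h, -⟩ := Nat.mem_divisorsAntidiagonal.1 h
        refine ⟨(a, b), Nat.mem_divisorsAntidiagonal.2 ⟨?_, (Nat.pos_of_mul_pos_left hn).ne'⟩, rfl⟩
        exact Nat.eq_of_mul_eq_mul_left (Nat.mul_pos hp0 hp0) (by linarith)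
      · intros; rfl
    · rw [Finset.sum_eq_zero]
      rintro ⟨a, b⟩ h
      obtain ⟨h, ⟨a, rfl⟩, b, rfl⟩ := Finset.mem_filter.1 h
      obtain ⟨h, -⟩ := Nat.mem_divisorsAntidiagonal.1 h
      exact absurd ⟨a * b, Nat.eq_of_mul_eq_mul_left hp0 (by rw [← h]; ring)⟩ hpn
  have h4 : ∑ x ∈ s with p ∣ x.1 ∨ p ∣ x.2, f x.1 x.2 = ∑ x ∈ s, f x.1 x.2 := by
    rw [Finset.filter_true_of_mem]
    rintro ⟨a, b⟩ h
    obtain ⟨h, -⟩ := Nat.mem_divisorsAntidiagonal.1 h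
    exact (hp.dvd_mul).1 ⟨n, h⟩
  rw [← h1, ← h2, ← h3, ← h4, Finset.filter_or, Finset.filter_and, eq_sub_iff_add_eq]
  exact Finset.sum_union_inter

lemma alphaFn_prime_mul {p n : ℕ} (hp : p.Prime) (hn : 0 < n) :
    alphaFn (p * n) = 2 * alphaFn n +
      Real.log p * ∑ x ∈ n.divisorsAntidiagonal, (Real.log x.1 + Real.log x.2) -
      if p ∣ n then ∑ x ∈ (n / p).divisorsAntidiagonal,
        Real.log (p * x.1 : ℕ) * Real.log (p * x.2 : ℕ) else 0 := by
  rw [alphaFn, sum_divisorsAntidiagonal_prime_mul hp hn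
    (fun a b => Real.log a * Real.log b), alphaFn]
  congr 1
  rw [Finset.mul_sum, Finset.mul_sum, ← Finset.sum_add_distrib, ← Finset.sum_add_distrib]
  refine Finset.sum_congr rfl fun x hx => ?_
  obtain ⟨h, hn⟩ := Nat.mem_divisorsAntidiagonal.1 hx
  have h1 : x.1 ≠ 0 := by rintro h0; simp [h0] at h; omega
  have h2 : x.2 ≠ 0 := by rintro h0; simp [h0] at h; omega
  have hp0 : (p : ℝ) ≠ 0 := by exact_mod_cast hp.ne_zero
  push_cast
  rw [Real.log_mul hp0 (by exact_mod_cast h1), Real.log_mul hp0 (by exact_mod_cast h2)]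
  ring

lemma card_divisorsAntidiagonal_prime_mul_le {p n : ℕ} (hp : p.Prime) (hn : 0 < n) :
    (((p * n).divisorsAntidiagonal.card : ℕ) : ℝ) ≤ 2 * (n.divisorsAntidiagonal.card : ℝ) := by
  have h := sum_divisorsAntidiagonal_prime_mul hp hn (fun _ _ => 1)
  simp only [Finset.sum_const, nsmul_eq_mul, mul_one] at h
  rw [h]
  split_ifs
  · linarith [(Nat.cast_nonneg (n / p).divisorsAntidiagonal.card : (0 : ℝ) ≤ _)]
  · linarith

lemma alphaFn_nonneg (n : ℕ) : 0 ≤ alphaFn n :=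
  Finset.sum_nonneg fun _ _ =>
    mul_nonneg (Real.log_natCast_nonneg _) (Real.log_natCast_nonneg _)

lemma alphaFn_le {n : ℕ} {t : ℝ} (hn : (n : ℝ) ≤ t) :
    alphaFn n ≤ n.divisorsAntidiagonal.card * Real.log t ^ 2 := by
  rw [← nsmul_eq_mul]
  refine Finset.sum_le_card_nsmul _ _ _ ?_
  rintro ⟨a, b⟩ h
  obtain ⟨h, hn0⟩ := Nat.mem_divisorsAntidiagonal.1 h
  have ha : 0 < a := by rcases Nat.eq_zero_or_pos a with rfl | h' <;> [simp at h; assumption]; omega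
  have hb : 0 < b := by rcases Nat.eq_zero_or_pos b with rfl | h' <;> [simp at h; assumption]; omega
  have h1 : a ≤ n := Nat.le_of_dvd (by omega) ⟨b, h.symm⟩
  have h2 : b ≤ n := Nat.le_of_dvd (by omega) ⟨a, by rw [← h, mul_comm]⟩
  have h1' : Real.log a ≤ Real.log t :=
    Real.log_le_log (by exact_mod_cast ha) (le_trans (by exact_mod_cast h1) hn)
  have h2' : Real.log b ≤ Real.log t :=
    Real.log_le_log (by exact_mod_cast hb) (le_trans (by exact_mod_cast h2) hn)
  have h3 := Real.log_natCast_nonneg a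
  have h4 := Real.log_natCast_nonneg b
  rw [sq]
  exact mul_le_mul h1' h2' h4 (h3.trans h1')

lemma sum_card_sq_div_le {t : ℝ} (ht : 1 ≤ t) :
    ∑ n ∈ Icc 1 ⌊t⌋₊, (n.divisorsAntidiagonal.card : ℝ) ^ 2 / n ≤ (1 + Real.log t) ^ 4 := by
  calc _ = ∑ n ∈ Icc 1 ⌊t⌋₊, ∑ x ∈ n.divisorsAntidiagonal, ∑ y ∈ n.divisorsAntidiagonal,
        1 / ((x.1 : ℝ) * x.2) := by
        refine Finset.sum_congr rfl fun n _ => ?_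
        rw [sq, mul_div_assoc, ← nsmul_eq_mul]
        symm
        refine Finset.sum_eq_card_nsmul fun x hx => ?_
        rw [Finset.sum_const, nsmul_eq_mul, ← Nat.cast_mul, (Nat.mem_divisorsAntidiagonal.1 hx).1]
        ring
    _ ≤ ∑ q ∈ prodQuads ⌊t⌋₊, 1 / ((q.1 : ℝ) * q.2.1 * q.2.2.1 * q.2.2.2) := by
        rw [sum_divisorsAntidiagonal_sq _ (fun a b _ _ => 1 / ((a : ℝ) * b))]
        refine (Finset.sum_le_sum_of_subset_of_nonneg (Finset.filter_subset _ _)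
          fun _ _ _ => by positivity).trans (le_of_eq ?_)
        refine Finset.sum_congr rfl fun q _ => ?_
        push_cast
        ring
    _ ≤ _ := sum_prodQuads_one_div_le ht

lemma sum_multiples {p : ℕ} (hp : 0 < p) (N : ℕ) (f : ℕ → ℝ) :
    ∑ n ∈ Icc 1 N with p ∣ n, f n = ∑ m ∈ Icc 1 (N / p), f (p * m) := by
  symm
  refine Finset.sum_nbij' (fun m => p * m) (fun n => n / p) ?_ ?_ ?_ ?_ ?_
  · intro m hm
    obtain ⟨h1, h2⟩ := Finset.mem_Icc.1 hm
    rw [Nat.le_div_iff_mul_le hp] at h2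
    exact Finset.mem_filter.2
      ⟨Finset.mem_Icc.2 ⟨Nat.mul_pos hp h1, by linarith⟩, dvd_mul_right _ _⟩
  · intro n hn
    obtain ⟨hn, m, rfl⟩ := Finset.mem_filter.1 hn
    obtain ⟨h1, h2⟩ := Finset.mem_Icc.1 hn
    rw [Nat.mul_div_cancel_left _ hp]
    refine Finset.mem_Icc.2 ⟨Nat.pos_of_mul_pos_left h1, ?_⟩
    rw [Nat.le_div_iff_mul_le hp]
    linarith
  · intro m _
    exact Nat.mul_div_cancel_left _ hp
  · intro n hn
    exact Nat.mul_div_cancel' (Finset.mem_filter.1 hn).2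
  · intros; rfl

lemma sum_alphaFn_mul_correction_le {t : ℝ} (ht : 1 ≤ t) {p : ℕ} (hp : p.Prime) :
    ∑ n ∈ Icc 1 ⌊t⌋₊, alphaFn n * (if p ∣ n then ∑ x ∈ (n / p).divisorsAntidiagonal,
        Real.log (p * x.1 : ℕ) * Real.log (p * x.2 : ℕ) else 0) / n ≤
      2 * Real.log t ^ 4 * (1 + Real.log t) ^ 4 / p := by
  have hl : 0 ≤ Real.log t := Real.log_nonneg ht
  have hp0 : (0 : ℝ) < p := by exact_mod_cast hp.pos
  calc _ = ∑ n ∈ Icc 1 ⌊t⌋₊ with p ∣ n, alphaFn n * (∑ x ∈ (n / p).divisorsAntidiagonal,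
        Real.log (p * x.1 : ℕ) * Real.log (p * x.2 : ℕ)) / n := by
        rw [Finset.sum_filter]
        refine Finset.sum_congr rfl fun n _ => ?_
        split_ifs <;> simp
    _ = ∑ m ∈ Icc 1 (⌊t⌋₊ / p), alphaFn (p * m) * (∑ x ∈ m.divisorsAntidiagonal,
        Real.log (p * x.1 : ℕ) * Real.log (p * x.2 : ℕ)) / (p * m : ℕ) := by
        rw [sum_multiples hp.pos _ (fun n => alphaFn n * (∑ x ∈ (n / p).divisorsAntidiagonal,
          Real.log (p * x.1 : ℕ) * Real.log (p * x.2 : ℕ)) / n)]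
        simp only [Nat.mul_div_cancel_left _ hp.pos]
    _ ≤ ∑ m ∈ Icc 1 (⌊t⌋₊ / p), 2 * Real.log t ^ 4 / p *
        ((m.divisorsAntidiagonal.card : ℝ) ^ 2 / m) := by
        refine Finset.sum_le_sum fun m hm => ?_
        obtain ⟨hm1, hm2⟩ := Finset.mem_Icc.1 hm
        rw [Nat.le_div_iff_mul_le hp.pos, mul_comm] at hm2
        have hmt : ((p * m : ℕ) : ℝ) ≤ t := (Nat.le_floor_iff (by linarith)).1 hm2
        have h1 := alphaFn_le hmt
        have h2 := card_divisorsAntidiagonal_prime_mul_le hp hm1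
        have h3 : ∑ x ∈ m.divisorsAntidiagonal, Real.log (p * x.1 : ℕ) * Real.log (p * x.2 : ℕ) ≤
            m.divisorsAntidiagonal.card * Real.log t ^ 2 := by
          rw [← nsmul_eq_mul]
          refine Finset.sum_le_card_nsmul _ _ _ ?_
          rintro ⟨a, b⟩ h
          obtain ⟨h, -⟩ := Nat.mem_divisorsAntidiagonal.1 h
          dsimp only at h ⊢
          have ha : 0 < a := Nat.pos_of_mul_pos_right (by omega : 0 < a * b)
          have hb : 0 < b := Nat.pos_of_mul_pos_left (by omega : 0 < a * b)
          have hle : ∀ c : ℕ, 0 < c → c ∣ m → Real.log (p * c : ℕ) ≤ Real.log t := by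
            intro c hc hcm
            refine Real.log_le_log (by exact_mod_cast Nat.mul_pos hp.pos hc) (le_trans ?_ hmt)
            exact_mod_cast Nat.mul_le_mul_left p (Nat.le_of_dvd hm1 hcm)
          rw [sq]
          exact mul_le_mul (hle a ha ⟨b, h.symm⟩) (hle b hb ⟨a, by rw [← h, mul_comm]⟩)
            (Real.log_natCast_nonneg _) hl
        have h4 : 0 ≤ ∑ x ∈ m.divisorsAntidiagonal,
            Real.log (p * x.1 : ℕ) * Real.log (p * x.2 : ℕ) :=
          Finset.sum_nonneg fun _ _ =>
            mul_nonneg (Real.log_natCast_nonneg _) (Real.log_natCast_nonneg _)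
        have hm0 : (0 : ℝ) < m := by exact_mod_cast hm1
        calc _ ≤ (2 * m.divisorsAntidiagonal.card * Real.log t ^ 2) *
              (m.divisorsAntidiagonal.card * Real.log t ^ 2) / (p * m : ℕ) := by
              gcongr
              exact h1.trans (by gcongr)
          _ = _ := by
              push_cast
              field_simp
    _ ≤ 2 * Real.log t ^ 4 / p *
        ∑ m ∈ Icc 1 ⌊t⌋₊, ((m.divisorsAntidiagonal.card : ℝ) ^ 2 / m) := by
        rw [← Finset.mul_sum]
        gcongr
        exact Nat.div_le_self _ _
    _ ≤ 2 * Real.log t ^ 4 / p * (1 + Real.log t) ^ 4 := by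
        gcongr
        exact sum_card_sq_div_le ht
    _ = _ := by ring

lemma logAsymp_prodQuads_mul_mul_mul :
    LogAsymp (fun x => ∑ q ∈ prodQuads ⌊x⌋₊,
      (Real.log q.1 + Real.log q.2.1) * (Real.log q.2.2.1 + Real.log q.2.2.2) *
        (Real.log q.1 + Real.log q.2.2.1) * (Real.log q.2.1 + Real.log q.2.2.2) /
          ((q.1 : ℝ) * q.2.1 * q.2.2.1 * q.2.2.2)) (17 / 20160) 7 := by
  have M : ∀ i j k l : ℕ, i + j + k + l = 4 → LogAsymp (fun x => ∑ q ∈ prodQuads ⌊x⌋₊,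
        Real.log q.1 ^ i * Real.log q.2.1 ^ j * Real.log q.2.2.1 ^ k * Real.log q.2.2.2 ^ l /
          ((q.1 : ℝ) * q.2.1 * q.2.2.1 * q.2.2.2))
      ((i.factorial : ℝ) * j.factorial * k.factorial * l.factorial / 40320) 7 := by
    intro i j k l h
    have h' := logAsymp_prodQuads i j k l
    rw [h] at h'
    norm_num [Nat.factorial_succ 7, Nat.factorial] at h'
    exact h'
  convert ((((((((((((((((M 2 1 1 0 rfl).add
      (M 2 0 1 1 rfl)).add
      (M 1 1 2 0 rfl)).add
      (M 1 0 2 1 rfl)).add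
      (M 2 1 0 1 rfl)).add
      (M 2 0 0 2 rfl)).add
      (M 1 1 1 1 rfl)).add
      (M 1 0 1 2 rfl)).add
      (M 1 2 1 0 rfl)).add
      (M 1 1 1 1 rfl)).add
      (M 0 2 2 0 rfl)).add
      (M 0 1 2 1 rfl)).add
      (M 1 2 0 1 rfl)).add
      (M 1 1 0 2 rfl)).add
      (M 0 2 1 1 rfl)).add
      (M 0 1 1 2 rfl)) using 1
  · funext x
    simp only [← Finset.sum_add_distrib]
    refine Finset.sum_congr rfl fun q _ => ?_
    ring
  · norm_num [Nat.factorial]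

lemma logAsymp_prodQuads_mul_mul_add :
    LogAsymp (fun x => ∑ q ∈ prodQuads ⌊x⌋₊,
      (Real.log q.1 + Real.log q.2.1) * (Real.log q.2.2.1 + Real.log q.2.2.2) *
        (Real.log q.1 + Real.log q.2.2.1 + (Real.log q.2.1 + Real.log q.2.2.2)) /
          ((q.1 : ℝ) * q.2.1 * q.2.2.1 * q.2.2.2)) (1 / 210) 6 := by
  have M : ∀ i j k l : ℕ, i + j + k + l = 3 → LogAsymp (fun x => ∑ q ∈ prodQuads ⌊x⌋₊,
        Real.log q.1 ^ i * Real.log q.2.1 ^ j * Real.log q.2.2.1 ^ k * Real.log q.2.2.2 ^ l /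
          ((q.1 : ℝ) * q.2.1 * q.2.2.1 * q.2.2.2))
      ((i.factorial : ℝ) * j.factorial * k.factorial * l.factorial / 5040) 6 := by
    intro i j k l h
    have h' := logAsymp_prodQuads i j k l
    rw [h] at h'
    norm_num [Nat.factorial_succ 6, Nat.factorial] at h'
    exact h'
  convert ((((((((((((((((M 2 0 1 0 rfl).add
      (M 1 0 2 0 rfl)).add
      (M 1 1 1 0 rfl)).add
      (M 1 0 1 1 rfl)).add
      (M 2 0 0 1 rfl)).add
      (M 1 0 1 1 rfl)).add
      (M 1 1 0 1 rfl)).add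
      (M 1 0 0 2 rfl)).add
      (M 1 1 1 0 rfl)).add
      (M 0 1 2 0 rfl)).add
      (M 0 2 1 0 rfl)).add
      (M 0 1 1 1 rfl)).add
      (M 1 1 0 1 rfl)).add
      (M 0 1 1 1 rfl)).add
      (M 0 2 0 1 rfl)).add
      (M 0 1 0 2 rfl)) using 1
  · funext x
    simp only [← Finset.sum_add_distrib]
    refine Finset.sum_congr rfl fun q _ => ?_
    ring
  · norm_num [Nat.factorial]

lemma abs_mul_mul_mul_shift_sub_le {l κ x y z w : ℝ} (hκ : 0 ≤ κ) (hκl : κ ≤ l)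
    (hx : 0 ≤ x) (hxl : x ≤ 2 * l) (hy : 0 ≤ y) (hyl : y ≤ 2 * l)
    (hz : 0 ≤ z) (hzl : z ≤ 2 * l) (hw : 0 ≤ w) (hwl : w ≤ 2 * l) :
    |(x + κ) * (y + κ) * (z + κ) * (w + κ) - x * y * z * w| ≤ 108 * κ * l ^ 3 := by
  have hl : 0 ≤ l := hκ.trans hκl
  rw [show (x + κ) * (y + κ) * (z + κ) * (w + κ) - x * y * z * w =
    κ * ((y + κ) * (z + κ) * (w + κ) + x * (z + κ) * (w + κ) + x * y * (w + κ) + x * y * z) by ring,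
    abs_of_nonneg (by positivity)]
  calc _ ≤ κ * ((3 * l) * (3 * l) * (3 * l) + (3 * l) * (3 * l) * (3 * l) +
        (3 * l) * (3 * l) * (3 * l) + (3 * l) * (3 * l) * (3 * l)) := by
        gcongr <;> linarith
    _ = _ := by ring

lemma abs_mul_mul_add_shift_sub_le {l κ x y z w : ℝ} (hκ : 0 ≤ κ) (hκl : κ ≤ l)
    (hx : 0 ≤ x) (hxl : x ≤ 2 * l) (hy : 0 ≤ y) (hyl : y ≤ 2 * l)
    (hz : 0 ≤ z) (hzl : z ≤ 2 * l) (hw : 0 ≤ w) (hwl : w ≤ 2 * l) :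
    |(x + κ) * (y + κ) * (z + κ + (w + κ)) - x * y * (z + w)| ≤ 54 * κ * l ^ 2 := by
  have hl : 0 ≤ l := hκ.trans hκl
  rw [show (x + κ) * (y + κ) * (z + κ + (w + κ)) - x * y * (z + w) =
    κ * ((y + κ) * (z + κ + (w + κ)) + x * (z + κ + (w + κ)) + x * y * 2) by ring,
    abs_of_nonneg (by positivity)]
  calc _ ≤ κ * ((3 * l) * (3 * l + 3 * l) + (3 * l) * (3 * l + 3 * l) + (3 * l) * (3 * l) * 2) := by
        gcongr <;> linarith
    _ = _ := by ring

lemma logAsymp_sum_alphaFn_sq :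
    LogAsymp (fun t => ∑ n ∈ Icc 1 ⌊t⌋₊, alphaFn n ^ 2 / n) (6 / Real.pi ^ 2 * (17 / 20160)) 7 := by
  convert logAsymp_sum_divisorsAntidiagonal_sq (W := fun x y z w => x * y * z * w) (r := 3)
    logAsymp_prodQuads_mul_mul_mul ⟨108, by norm_num, fun l κ x y z w hκ hκl hx hxl hy hyl hz hzl hw
      hwl => abs_mul_mul_mul_shift_sub_le hκ hκl hx hxl hy hyl hz hzl hw hwl⟩ using 5 with t n
  rw [alphaFn, sq, Finset.sum_mul_sum]
  simp only [mul_assoc]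

lemma logAsymp_sum_alphaFn_mul_sum_log :
    LogAsymp (fun t => ∑ n ∈ Icc 1 ⌊t⌋₊,
      alphaFn n * (∑ x ∈ n.divisorsAntidiagonal, (Real.log x.1 + Real.log x.2)) / n)
      (6 / Real.pi ^ 2 * (1 / 210)) 6 := by
  convert logAsymp_sum_divisorsAntidiagonal_sq (W := fun x y z w => x * y * (z + w)) (r := 2)
    logAsymp_prodQuads_mul_mul_add ⟨54, by norm_num, fun l κ x y z w hκ hκl hx hxl hy hyl hz hzl hw
      hwl => abs_mul_mul_add_shift_sub_le hκ hκl hx hxl hy hyl hz hzl hw hwl⟩ using 5 with t n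
  rw [alphaFn, Finset.sum_mul_sum]

theorem alpha_alpha_shifted_sum :
    ∃ K : ℝ, 0 < K ∧ ∀ t : ℝ, 3 ≤ t → ∀ p : ℕ, p.Prime → (p : ℝ) ≤ t →
      |(∑ n ∈ Finset.Icc 1 ⌊t⌋₊, alphaFn n * alphaFn (p * n) / n) -
          6 / Real.pi ^ 2 *
            (17 / 10080 * Real.log t ^ 8 + 1 / 210 * Real.log t ^ 7 * Real.log p)|
        ≤ K * (Real.log t ^ 7 + Real.log t ^ 8 / p) := by
  obtain ⟨C, hC, hA⟩ := logAsymp_sum_alphaFn_sq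
  obtain ⟨D, hD, hB⟩ := logAsymp_sum_alphaFn_mul_sum_log
  refine ⟨256 * C + 64 * D + 32, by positivity, fun t ht p hp hpt => ?_⟩
  have ht1 : 1 ≤ t := by linarith
  specialize hA t ht1
  specialize hB t ht1
  have hR := sum_alphaFn_mul_correction_le ht1 hp
  have hl1 : 1 ≤ Real.log t := by
    rw [Real.le_log_iff_exp_le (by linarith)]
    exact (Real.exp_one_lt_d9.le.trans (by norm_num)).trans ht
  have hp0 : (0 : ℝ) < p := by exact_mod_cast hp.pos
  have hq0 : 0 ≤ Real.log p := Real.log_natCast_nonneg p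
  have hql : Real.log p ≤ Real.log t := Real.log_le_log hp0 hpt
  have hl : 1 + Real.log t ≤ 2 * Real.log t := by linarith
  beta_reduce at hA hB
  have hR0 : 0 ≤ ∑ n ∈ Icc 1 ⌊t⌋₊,
      alphaFn n * (if p ∣ n then ∑ x ∈ (n / p).divisorsAntidiagonal,
        Real.log (p * x.1 : ℕ) * Real.log (p * x.2 : ℕ) else 0) / n := by
    refine Finset.sum_nonneg fun n _ => div_nonneg (mul_nonneg (alphaFn_nonneg n) ?_) (by positivity)
    split_ifs
    · exact Finset.sum_nonneg fun _ _ =>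
        mul_nonneg (Real.log_natCast_nonneg _) (Real.log_natCast_nonneg _)
    · exact le_rfl
  have hS : ∑ n ∈ Icc 1 ⌊t⌋₊, alphaFn n * alphaFn (p * n) / n =
      2 * ∑ n ∈ Icc 1 ⌊t⌋₊, alphaFn n ^ 2 / n + Real.log p * ∑ n ∈ Icc 1 ⌊t⌋₊,
        alphaFn n * (∑ x ∈ n.divisorsAntidiagonal, (Real.log x.1 + Real.log x.2)) / n -
      ∑ n ∈ Icc 1 ⌊t⌋₊, alphaFn n * (if p ∣ n then ∑ x ∈ (n / p).divisorsAntidiagonal,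
        Real.log (p * x.1 : ℕ) * Real.log (p * x.2 : ℕ) else 0) / n := by
    rw [Finset.mul_sum, Finset.mul_sum, ← Finset.sum_add_distrib, ← Finset.sum_sub_distrib]
    refine Finset.sum_congr rfl fun n hn => ?_
    rw [alphaFn_prime_mul hp (Finset.mem_Icc.1 hn).1]
    ring
  rw [hS]
  set A := ∑ n ∈ Icc 1 ⌊t⌋₊, alphaFn n ^ 2 / n
  set B := ∑ n ∈ Icc 1 ⌊t⌋₊,
    alphaFn n * (∑ x ∈ n.divisorsAntidiagonal, (Real.log x.1 + Real.log x.2)) / n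
  set R := ∑ n ∈ Icc 1 ⌊t⌋₊, alphaFn n * (if p ∣ n then ∑ x ∈ (n / p).divisorsAntidiagonal,
    Real.log (p * x.1 : ℕ) * Real.log (p * x.2 : ℕ) else 0) / n
  set l := Real.log t
  set q := Real.log p
  have h1 : |2 * (A - 6 / Real.pi ^ 2 * (17 / 20160) * l ^ (7 + 1))| ≤ 256 * C * l ^ 7 := by
    rw [abs_mul, abs_of_pos two_pos]
    calc _ ≤ 2 * (C * (2 * l) ^ 7) := by gcongr; exact hA.trans (by gcongr)
      _ = _ := by ring
  have h2 : |q * (B - 6 / Real.pi ^ 2 * (1 / 210) * l ^ (6 + 1))| ≤ 64 * D * l ^ 7 := by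
    rw [abs_mul, abs_of_nonneg hq0]
    calc _ ≤ l * (D * (2 * l) ^ 6) := by gcongr; exact hB.trans (by gcongr)
      _ = _ := by ring
  have h3 : |R| ≤ 32 * (l ^ 8 / p) := by
    rw [abs_of_nonneg hR0]
    calc R ≤ _ := hR
      _ ≤ 2 * l ^ 4 * (2 * l) ^ 4 / p := by gcongr
      _ = _ := by ring
  have h7 : 0 ≤ l ^ 7 := by positivity
  have h8 : 0 ≤ l ^ 8 / p := by positivity
  calc _ = |2 * (A - 6 / Real.pi ^ 2 * (17 / 20160) * l ^ (7 + 1)) +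
        q * (B - 6 / Real.pi ^ 2 * (1 / 210) * l ^ (6 + 1)) + -R| := by congr 1; ring
    _ ≤ _ := abs_add_three _ _ _
    _ ≤ 256 * C * l ^ 7 + 64 * D * l ^ 7 + 32 * (l ^ 8 / p) := by
        rw [abs_neg]
        exact add_le_add (add_le_add h1 h2) h3
    _ ≤ (256 * C + 64 * D + 32) * (l ^ 7 + l ^ 8 / p) := by
        have := mul_nonneg (by positivity : 0 ≤ 256 * C + 64 * D) h8
        linarith
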